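/- For every complex q with |q| < 1, σ₂(q) = (1/(-q;q)_∞) · { 1 + ∑_{n=1}^{∞} q^{n(n+1)/2} ∑_{m=1}^{n} [n-1 choose m-1]_q · q^{m²} / (q;q)_m }. -/

import Mathlib

open scoped BigOperators

/-- The finite q-Pochhammer symbol `(a;q)_n`. -/
noncomputable def qPoch (a q : ℂ) (n : ℕ) : ℂ := ∏ k ∈ Finset.range n, (1 - a * q ^ k)

/-- The infinite q-Pochhammer symbol `(a;q)_∞`. -/
noncomputable def qPochInf (a q : ℂ) : ℂ := ∏' k : ℕ, (1 - a * q ^ k)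

/-- The Gaussian binomial coefficient `[N choose n]_q`. -/
noncomputable def qbinom (q : ℂ) (N n : ℕ) : ℂ :=
  if n ≤ N then qPoch q q N / (qPoch q q n * qPoch q q (N - n)) else 0

/-- The rank parity function `σ₂(q)` associated to Rogers–Ramanujan partitions. -/
noncomputable def sigma2 (q : ℂ) : ℂ := ∑' n : ℕ, (-1) ^ n * q ^ (n ^ 2) / qPoch (-q) q n

open Filter Topology Finset

lemma qPoch_succ (a q : ℂ) (n : ℕ) : qPoch a q (n + 1) = qPoch a q n * (1 - a * q ^ n) :=
  Finset.prod_range_succ _ _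

lemma qPoch_zero (a q : ℂ) : qPoch a q 0 = 1 := Finset.prod_range_zero _

lemma one_sub_pow_succ_ne_zero {q : ℂ} (hq : ‖q‖ < 1) (n : ℕ) : 1 - q ^ (n + 1) ≠ 0 := by
  intro h
  have h1 : ‖q ^ (n + 1)‖ = 1 := by rw [← sub_eq_zero.mp h]; simp
  rw [norm_pow] at h1
  exact absurd h1 (pow_lt_one₀ (norm_nonneg _) hq (by omega)).ne

lemma one_add_pow_succ_ne_zero {q : ℂ} (hq : ‖q‖ < 1) (n : ℕ) : 1 + q ^ (n + 1) ≠ 0 := by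
  intro h
  have h1 : ‖q ^ (n + 1)‖ = 1 := by rw [eq_neg_of_add_eq_zero_right h]; simp
  rw [norm_pow] at h1
  exact absurd h1 (pow_lt_one₀ (norm_nonneg _) hq (by omega)).ne

lemma qPoch_self_succ (q : ℂ) (n : ℕ) :
    qPoch q q (n + 1) = qPoch q q n * (1 - q ^ (n + 1)) := by
  rw [qPoch_succ]; ring

lemma qPoch_self_ne_zero {q : ℂ} (hq : ‖q‖ < 1) (n : ℕ) : qPoch q q n ≠ 0 := by
  refine Finset.prod_ne_zero_iff.mpr fun k _ => ?_
  have := one_sub_pow_succ_ne_zero hq k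
  rwa [pow_succ'] at this

lemma qPoch_neg_ne_zero {q : ℂ} (hq : ‖q‖ < 1) (n : ℕ) : qPoch (-q) q n ≠ 0 := by
  refine Finset.prod_ne_zero_iff.mpr fun k _ => ?_
  have := one_add_pow_succ_ne_zero hq k
  rw [pow_succ'] at this
  simpa using this

lemma qbinom_zero_right {q : ℂ} (hq : ‖q‖ < 1) (n : ℕ) : qbinom q n 0 = 1 := by
  simp [qbinom, qPoch_zero, qPoch_self_ne_zero hq]

lemma qbinom_of_lt (q : ℂ) {n m : ℕ} (h : n < m) : qbinom q n m = 0 := by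
  simp [qbinom, h]

/-- The `q`-Pascal rule. -/
lemma qbinom_succ_succ {q : ℂ} (hq : ‖q‖ < 1) {n m : ℕ} (h : m ≤ n) :
    qbinom q (n + 1) (m + 1) = qbinom q n (m + 1) + q ^ (n - m) * qbinom q n m := by
  obtain ⟨d, rfl⟩ := Nat.exists_eq_add_of_le h
  have e1 : m + d + 1 - (m + 1) = d := by omega
  have e2 : m + d - m = d := by omega
  rcases d with _ | d
  · have := qPoch_self_ne_zero hq
    simp [qbinom, qPoch_zero, this]
  · have e3 : m + (d + 1) - (m + 1) = d := by omega
    have hm : m + 1 ≤ m + (d + 1) := by omega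
    simp only [qbinom, e1, e2, e3, if_pos hm, h, Nat.add_le_add_right h 1, if_true]
    rw [qPoch_self_succ q (m + (d + 1)), qPoch_self_succ q m, qPoch_self_succ q d]
    have a1 := qPoch_self_ne_zero hq m
    have a2 := qPoch_self_ne_zero hq d
    have a3 := one_sub_pow_succ_ne_zero hq m
    have a4 := one_sub_pow_succ_ne_zero hq d
    field_simp
    ring

lemma one_sub_mul_qbinom {q : ℂ} (hq : ‖q‖ < 1) {n m : ℕ} (h : m ≤ n + 1) :
    (1 - q ^ (n + 1)) * qbinom q n m = (1 - q ^ (n + 1 - m)) * qbinom q (n + 1) m := by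
  rcases h.eq_or_lt with rfl | h
  · simp [qbinom_of_lt q (Nat.lt_succ_self n)]
  · obtain ⟨d, rfl⟩ := Nat.exists_eq_add_of_le (Nat.lt_succ_iff.mp h)
    have e1 : m + d + 1 - m = d + 1 := by omega
    have e2 : m + d - m = d := by omega
    simp only [qbinom, e1, e2, if_pos h.le, Nat.le_add_right, if_true]
    rw [qPoch_self_succ q (m + d), qPoch_self_succ q d]
    have a1 := qPoch_self_ne_zero hq m
    have a2 := qPoch_self_ne_zero hq d
    have a4 := one_sub_pow_succ_ne_zero hq d
    field_simp

/-- A finite form of Cauchy's identity. -/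
lemma sum_qbinom_mul_pow_div {q : ℂ} (hq : ‖q‖ < 1) (n s : ℕ) :
    ∑ m ∈ range (n + 1), qbinom q n m * q ^ (m ^ 2 + s * m) / qPoch q q (m + s) =
      1 / qPoch q q (n + s) := by
  induction n generalizing s with
  | zero => simp [qbinom_zero_right hq]
  | succ n ih =>
    have key : ∀ m ∈ range (n + 1),
        qbinom q (n + 1) (m + 1) * q ^ ((m + 1) ^ 2 + s * (m + 1)) / qPoch q q (m + 1 + s) =
        qbinom q n (m + 1) * q ^ ((m + 1) ^ 2 + s * (m + 1)) / qPoch q q (m + 1 + s) +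
        q ^ (n + 1 + s) * (qbinom q n m * q ^ (m ^ 2 + (s + 1) * m) / qPoch q q (m + (s + 1))) := by
      intro m hm
      have hm : m ≤ n := Nat.lt_succ_iff.mp (mem_range.mp hm)
      obtain ⟨d, rfl⟩ := Nat.exists_eq_add_of_le hm
      rw [qbinom_succ_succ hq hm, show m + (s + 1) = m + 1 + s by ring,
        show m + d - m = d by omega]
      ring
    have h0 := ih s
    rw [← add_zero (∑ m ∈ range (n + 1), _),
      show (0 : ℂ) = qbinom q n (n + 1) * q ^ ((n + 1) ^ 2 + s * (n + 1)) / qPoch q q (n + 1 + s) by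
        simp [qbinom_of_lt q (Nat.lt_succ_self n)], ← sum_range_succ (fun m =>
          qbinom q n m * q ^ (m ^ 2 + s * m) / qPoch q q (m + s)), sum_range_succ'] at h0
    rw [sum_range_succ', sum_congr rfl key, sum_add_distrib, ← mul_sum, ih (s + 1),
      qbinom_zero_right hq]
    rw [qbinom_zero_right hq] at h0
    rw [add_right_comm, h0, show n + (s + 1) = n + s + 1 by ring,
      show n + 1 + s = n + s + 1 by ring, qPoch_self_succ]
    have a1 := qPoch_self_ne_zero hq (n + s)
    have a2 := one_sub_pow_succ_ne_zero hq (n + s)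
    field_simp
    ring

/-- The alternating sum over the antidiagonal satisfies a first-order recurrence. -/
lemma sum_antidiagonal_choose_recurrence {q : ℂ} (hq : ‖q‖ < 1) (n : ℕ) :
    ∑ p ∈ antidiagonal (n + 1), (-1) ^ p.1 * q ^ (p.1.choose 2) / qPoch q q p.2 =
      (1 - q ^ n) * ∑ p ∈ antidiagonal n, (-1) ^ p.1 * q ^ (p.1.choose 2) / qPoch q q p.2 +
        q ^ (n + 1) / qPoch q q (n + 1) := by
  have h1 := Nat.sum_antidiagonal_succ (n := n)
    (f := fun p => (-1) ^ p.1 * q ^ (p.1.choose 2) / qPoch q q p.2 * q ^ p.2)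
  have h2 := Nat.sum_antidiagonal_succ' (n := n)
    (f := fun p => (-1) ^ p.1 * q ^ (p.1.choose 2) / qPoch q q p.2 * q ^ p.2)
  have h3 := Nat.sum_antidiagonal_succ' (n := n)
    (f := fun p => (-1) ^ p.1 * q ^ (p.1.choose 2) / qPoch q q p.2)
  have h4 : ∑ p ∈ antidiagonal n, (-1) ^ p.1 * q ^ (p.1.choose 2) / qPoch q q (p.2 + 1) =
      ∑ p ∈ antidiagonal n, (-1) ^ p.1 * q ^ (p.1.choose 2) / qPoch q q p.2 +
      ∑ p ∈ antidiagonal n,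
        (-1) ^ p.1 * q ^ (p.1.choose 2) / qPoch q q (p.2 + 1) * q ^ (p.2 + 1) := by
    rw [← sum_add_distrib]
    refine sum_congr rfl fun p _ => ?_
    rw [qPoch_self_succ]
    have a1 := qPoch_self_ne_zero hq p.2
    have a2 := one_sub_pow_succ_ne_zero hq p.2
    field_simp
    ring
  have h5 : ∑ p ∈ antidiagonal n,
      (-1) ^ (p.1 + 1) * q ^ ((p.1 + 1).choose 2) / qPoch q q p.2 * q ^ p.2 =
      - q ^ n * ∑ p ∈ antidiagonal n, (-1) ^ p.1 * q ^ (p.1.choose 2) / qPoch q q p.2 := by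
    rw [mul_sum]
    refine sum_congr rfl fun p hp => ?_
    rw [← mem_antidiagonal.mp hp, Nat.choose_succ_succ', Nat.choose_one_right]
    ring
  simp only [h5, pow_zero, mul_one, Nat.choose_zero_succ] at h1 h2 h3
  rw [h3, h4]
  rw [h1] at h2
  linear_combination -h2

lemma sum_antidiagonal_eq_sum_qbinom {q : ℂ} (hq : ‖q‖ < 1) (n : ℕ) :
    ∑ p ∈ antidiagonal (n + 1), (-1) ^ p.1 * q ^ (p.1.choose 2) / qPoch q q p.2 =
      ∑ m ∈ range (n + 1), qbinom q n m * q ^ ((m + 1) ^ 2) / qPoch q q (m + 1) := by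
  induction n with
  | zero =>
    rw [sum_antidiagonal_choose_recurrence hq]
    simp [qbinom_zero_right hq]
  | succ n ih =>
    rw [sum_antidiagonal_choose_recurrence hq, ih, div_eq_mul_one_div (q ^ (n + 1 + 1)),
      ← sum_qbinom_mul_pow_div hq (n + 1) 1, mul_sum, mul_sum,
      ← add_zero (∑ m ∈ range (n + 1), _),
      show (0 : ℂ) = (1 - q ^ (n + 1)) *
          (qbinom q n (n + 1) * q ^ ((n + 1 + 1) ^ 2) / qPoch q q (n + 1 + 1)) by
        simp [qbinom_of_lt q (Nat.lt_succ_self n)],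
      ← sum_range_succ (fun m => (1 - q ^ (n + 1)) *
          (qbinom q n m * q ^ ((m + 1) ^ 2) / qPoch q q (m + 1))), ← sum_add_distrib]
    refine sum_congr rfl fun m hm => ?_
    have hm : m ≤ n + 1 := Nat.lt_succ_iff.mp (mem_range.mp hm)
    rw [mul_div_assoc, ← mul_assoc, one_sub_mul_qbinom hq hm]
    obtain ⟨d, hd⟩ := Nat.exists_eq_add_of_le hm
    rw [hd, show m + d - m = d by omega]
    ring

/-- The coefficients in Euler's expansion of `(-q;q)_∞`. -/
noncomputable def eulerCoeff (q : ℂ) (k : ℕ) : ℂ := q ^ ((k + 1).choose 2) / qPoch q q k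

lemma eulerCoeff_succ_mul {q : ℂ} (hq : ‖q‖ < 1) (k : ℕ) :
    eulerCoeff q (k + 1) * (1 - q ^ (k + 1)) = q ^ (k + 1) * eulerCoeff q k := by
  rw [eulerCoeff, eulerCoeff, qPoch_self_succ, Nat.choose_succ_succ' (k + 1),
    Nat.choose_one_right]
  have a1 := qPoch_self_ne_zero hq k
  have a2 := one_sub_pow_succ_ne_zero hq k
  field_simp
  ring

lemma summable_eulerCoeff {q : ℂ} (hq : ‖q‖ < 1) : Summable fun k => ‖eulerCoeff q k‖ := by
  have ht : Tendsto (fun k : ℕ => ‖q ^ (k + 1) / (1 - q ^ (k + 1))‖) atTop (𝓝 0) := by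
    have h0 : Tendsto (fun k : ℕ => q ^ (k + 1)) atTop (𝓝 0) :=
      (tendsto_pow_atTop_nhds_zero_of_norm_lt_one hq).comp (tendsto_add_atTop_nat 1)
    have h1 := (h0.div (h0.const_sub 1) (by simp)).norm
    simpa using h1
  refine summable_of_ratio_norm_eventually_le (r := 1 / 2) (by norm_num) ?_
  filter_upwards [ht.eventually (gt_mem_nhds (by norm_num : (0 : ℝ) < 1 / 2))] with k hk
  have : eulerCoeff q (k + 1) = q ^ (k + 1) / (1 - q ^ (k + 1)) * eulerCoeff q k := by
    rw [div_mul_eq_mul_div, eq_div_iff (one_sub_pow_succ_ne_zero hq k), eulerCoeff_succ_mul hq]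
  rw [norm_norm, norm_norm, this, norm_mul]
  gcongr

/-- Euler's series for `(-q^{n+1};q)_∞`. -/
noncomputable def eulerSeries (q : ℂ) (n : ℕ) : ℂ := ∑' k, eulerCoeff q k * q ^ (n * k)

lemma norm_eulerCoeff_mul_le {q : ℂ} (hq : ‖q‖ < 1) (k j : ℕ) :
    ‖eulerCoeff q k * q ^ j‖ ≤ ‖eulerCoeff q k‖ := by
  rw [norm_mul, norm_pow]
  exact mul_le_of_le_one_right (norm_nonneg _) (pow_le_one₀ (norm_nonneg _) hq.le)

lemma summable_eulerSeries {q : ℂ} (hq : ‖q‖ < 1) (n : ℕ) :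
    Summable fun k => eulerCoeff q k * q ^ (n * k) :=
  .of_norm_bounded (summable_eulerCoeff hq) fun _ => norm_eulerCoeff_mul_le hq _ _

lemma eulerSeries_eq_mul_succ {q : ℂ} (hq : ‖q‖ < 1) (n : ℕ) :
    eulerSeries q n = (1 + q ^ (n + 1)) * eulerSeries q (n + 1) := by
  have s0 := summable_eulerSeries hq n
  have s1 := summable_eulerSeries hq (n + 1)
  have h : eulerSeries q n - eulerSeries q (n + 1) = q ^ (n + 1) * eulerSeries q (n + 1) := by
    rw [eulerSeries, eulerSeries, ← s0.tsum_sub s1, (s0.sub s1).tsum_eq_zero_add, ← tsum_mul_left]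
    simp only [mul_zero, sub_self, zero_add]
    refine tsum_congr fun k => ?_
    linear_combination (q ^ (n * (k + 1))) * eulerCoeff_succ_mul hq k
  linear_combination h

lemma eulerSeries_zero_eq {q : ℂ} (hq : ‖q‖ < 1) (n : ℕ) :
    eulerSeries q 0 = qPoch (-q) q n * eulerSeries q n := by
  induction n with
  | zero => simp [qPoch_zero]
  | succ n ih => rw [ih, eulerSeries_eq_mul_succ hq, qPoch_succ]; ring

lemma tendsto_eulerSeries {q : ℂ} (hq : ‖q‖ < 1) :
    Tendsto (eulerSeries q) atTop (𝓝 1) := by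
  have h := tendsto_tsum_of_dominated_convergence (𝓕 := atTop)
    (f := fun n k => eulerCoeff q k * q ^ (n * k)) (g := fun k => if k = 0 then (1 : ℂ) else 0)
    (summable_eulerCoeff hq) ?_ (.of_forall fun n k => norm_eulerCoeff_mul_le hq _ _)
  · rwa [tsum_ite_eq] at h
  · intro k
    rcases k with _ | k
    · simp [eulerCoeff, qPoch_zero]
    · have h1 : ‖q ^ (k + 1)‖ < 1 := by
        rw [norm_pow]; exact pow_lt_one₀ (norm_nonneg _) hq (by omega)
      have h2 := (tendsto_pow_atTop_nhds_zero_of_norm_lt_one h1).const_mul (eulerCoeff q (k + 1))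
      simpa [← pow_mul, mul_comm] using h2

lemma qPochInf_neg_eq {q : ℂ} (hq : ‖q‖ < 1) : qPochInf (-q) q = eulerSeries q 0 := by
  have hm : Multipliable fun k : ℕ => 1 - -q * q ^ k := by
    have : Summable fun k : ℕ => ‖q * q ^ k‖ := by
      simpa using (summable_geometric_of_lt_one (norm_nonneg q) hq).mul_left ‖q‖
    simpa using multipliable_one_add_of_summable this
  have h1 := hm.hasProd.tendsto_prod_nat.mul (tendsto_eulerSeries hq)
  have h2 : Tendsto (fun _ : ℕ => eulerSeries q 0) atTop (𝓝 (qPochInf (-q) q * 1)) :=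
    h1.congr fun n => (eulerSeries_zero_eq hq n).symm
  simpa using tendsto_nhds_unique h2 tendsto_const_nhds

lemma eulerSeries_zero_ne_zero {q : ℂ} (hq : ‖q‖ < 1) : eulerSeries q 0 ≠ 0 := by
  obtain ⟨n, hn⟩ := ((tendsto_eulerSeries hq).eventually_ne one_ne_zero).exists
  rw [eulerSeries_zero_eq hq n]
  exact mul_ne_zero (qPoch_neg_ne_zero hq n) hn

lemma summable_pow_sq_mul_eulerCoeff {q : ℂ} (hq : ‖q‖ < 1) :
    Summable fun p : ℕ × ℕ =>
      (-1) ^ p.1 * q ^ (p.1 ^ 2) * (eulerCoeff q p.2 * q ^ (p.1 * p.2)) := by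
  refine .of_norm_bounded ((summable_geometric_of_lt_one (norm_nonneg q) hq).mul_of_nonneg
    (summable_eulerCoeff hq) (fun _ => by positivity) (fun _ => by positivity)) fun p => ?_
  rw [norm_mul]
  refine mul_le_mul ?_ (norm_eulerCoeff_mul_le hq _ _) (norm_nonneg _) (by positivity)
  simp only [norm_mul, norm_pow, norm_neg, norm_one, one_pow, one_mul]
  exact pow_le_pow_of_le_one (norm_nonneg _) hq.le (Nat.le_self_pow two_ne_zero _)

lemma qPochInf_mul_sigma2 {q : ℂ} (hq : ‖q‖ < 1) :
    qPochInf (-q) q * sigma2 q = ∑' n : ℕ, q ^ ((n + 1).choose 2) *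
      ∑ p ∈ antidiagonal n, (-1) ^ p.1 * q ^ (p.1.choose 2) / qPoch q q p.2 ∧
    Summable fun n : ℕ => q ^ ((n + 1).choose 2) *
      ∑ p ∈ antidiagonal n, (-1) ^ p.1 * q ^ (p.1.choose 2) / qPoch q q p.2 := by
  have hs := summable_pow_sq_mul_eulerCoeff hq
  have hs' := (HasAntidiagonal.sigmaAntidiagonalEquivProd : _ ≃ ℕ × ℕ).summable_iff.mpr hs
  have hterm : ∀ n : ℕ, q ^ ((n + 1).choose 2) *
      ∑ p ∈ antidiagonal n, (-1) ^ p.1 * q ^ (p.1.choose 2) / qPoch q q p.2 =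
      ∑' p : antidiagonal n, (-1) ^ p.1.1 * q ^ (p.1.1 ^ 2) *
        (eulerCoeff q p.1.2 * q ^ (p.1.1 * p.1.2)) := by
    intro n
    rw [Finset.tsum_subtype (antidiagonal n) (fun p : ℕ × ℕ => (-1) ^ p.1 * q ^ (p.1 ^ 2) *
        (eulerCoeff q p.2 * q ^ (p.1 * p.2))), mul_sum]
    refine sum_congr rfl fun p hp => ?_
    have he : (n + 1).choose 2 + p.1.choose 2 = p.1 ^ 2 + (p.2 + 1).choose 2 + p.1 * p.2 := by
      rw [← mem_antidiagonal.mp hp]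
      generalize p.2 = k
      induction k with
      | zero =>
        generalize p.1 = j
        induction j with
        | zero => simp
        | succ j ih =>
          simp only [add_zero, zero_add, mul_zero, Nat.choose_succ_succ' _ 1,
            Nat.choose_one_right] at ih ⊢
          simp at ih ⊢
          linarith
      | succ k ih =>
        rw [← add_assoc, Nat.choose_succ_succ' (p.1 + k + 1), Nat.choose_succ_succ' (k + 1),
          Nat.choose_one_right, Nat.choose_one_right]
        linarith
    have he' := congrArg (q ^ ·) he
    simp only [pow_add] at he'
    rw [eulerCoeff]
    linear_combination (-1) ^ p.1 / qPoch q q p.2 * he'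
  constructor
  · simp_rw [hterm]
    have h1 := hs'.tsum_sigma
    have h2 := (HasAntidiagonal.sigmaAntidiagonalEquivProd : _ ≃ ℕ × ℕ).tsum_eq
      (fun p : ℕ × ℕ => (-1) ^ p.1 * q ^ (p.1 ^ 2) * (eulerCoeff q p.2 * q ^ (p.1 * p.2)))
    refine Eq.trans ?_ (hs.tsum_prod.symm.trans (h2.symm.trans h1))
    rw [sigma2, ← tsum_mul_left]
    refine tsum_congr fun n => ?_
    dsimp only
    rw [tsum_mul_left, ← eulerSeries, qPochInf_neg_eq hq, eulerSeries_zero_eq hq n]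
    have := qPoch_neg_ne_zero hq n
    field_simp
  · simp_rw [hterm]
    exact hs'.sigma

theorem sigma2_double_sum (q : ℂ) (hq : ‖q‖ < 1) :
    sigma2 q = (1 / qPochInf (-q) q) *
      (1 + ∑' n : ℕ, q ^ ((n + 1) * (n + 2) / 2) *
        ∑ m ∈ Finset.range (n + 1),
          qbinom q n m * q ^ ((m + 1) ^ 2) / qPoch q q (m + 1)) := by
  obtain ⟨h, hs⟩ := qPochInf_mul_sigma2 hq
  have h0 : qPochInf (-q) q ≠ 0 := qPochInf_neg_eq hq ▸ eulerSeries_zero_ne_zero hq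
  rw [one_div, eq_inv_mul_iff_mul_eq₀ h0, h, hs.tsum_eq_zero_add]
  congr 1
  · simp [qPoch_zero]
  · refine tsum_congr fun n => ?_
    rw [sum_antidiagonal_eq_sum_qbinom hq, Nat.choose_two_right, Nat.add_sub_cancel,
      mul_comm (n + 1 + 1)]
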